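/- Let φ : ℚ_p → ℂ be locally constant with compact support, vanishing on a neighborhood of 0, and define the inversion Iφ(t) = |t|_p^{−1}·φ(t^{−1}) for t ≠ 0, Iφ(0) = 0 (so Iφ is again locally constant, compactly supported, and vanishing near 0). Then for every t ≠ 0, H(Iφ)(t) = |t|_p^{−1}·H(φ)(t^{−1}). (The conductor operator on ℚ_p commutes with the inversion I.) -/

import Mathlib

open MeasureTheory Complex
open scoped Classical

variable {p : ℕ} [Fact p.Prime]

/-- The `p`-adic Fourier transform `𝓕f(ξ) = ∫ f(t)·e(tξ) dμ(t)`. -/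
noncomputable def padicFourier [MeasurableSpace ℚ_[p]] (μ : Measure ℚ_[p])
    (e : AddChar ℚ_[p] Circle) (f : ℚ_[p] → ℂ) (ξ : ℚ_[p]) : ℂ :=
  ∫ t, f t * (e (t * ξ) : ℂ) ∂μ

/-- The inverse `p`-adic Fourier transform `𝓕⁻¹f(t) = ∫ f(ξ)·e(−tξ) dμ(ξ)`. -/
noncomputable def padicFourierInv [MeasurableSpace ℚ_[p]] (μ : Measure ℚ_[p])
    (e : AddChar ℚ_[p] Circle) (f : ℚ_[p] → ℂ) (t : ℚ_[p]) : ℂ :=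
  ∫ ξ, f ξ * (e (-(t * ξ)) : ℂ) ∂μ

/-- The conductor operator on `ℚ_p`:
`H(φ)(t) = log|t|_p·φ(t) + ∫ log|ξ|_p·(𝓕⁻¹φ)(ξ)·e(tξ) dμ(ξ)`. -/
noncomputable def padicCondOp [MeasurableSpace ℚ_[p]] (μ : Measure ℚ_[p])
    (e : AddChar ℚ_[p] Circle) (φ : ℚ_[p] → ℂ) (t : ℚ_[p]) : ℂ :=
  (Real.log ‖t‖ : ℂ) * φ t +
    ∫ ξ, (Real.log ‖ξ‖ : ℂ) * padicFourierInv μ e φ ξ * (e (t * ξ) : ℂ) ∂μ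

open scoped Pointwise in
theorem pcc_measure_p [MeasurableSpace ℚ_[p]] [BorelSpace ℚ_[p]]
    (μ : Measure ℚ_[p]) [μ.IsAddHaarMeasure] :
    μ {x : ℚ_[p] | ‖x‖ ≤ 1} = (p : ENNReal) * μ {x : ℚ_[p] | ‖x‖ < 1} := by
  have hU : {x : ℚ_[p] | ‖x‖ ≤ 1} = ⋃ i ∈ Finset.range p, {x : ℚ_[p] | ‖-(i:ℚ_[p]) + x‖ < 1} := by
    ext x
    simp only [Set.mem_ofPred_eq, Finset.mem_range, Set.mem_iUnion, exists_prop]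
    constructor
    · intro hx
      obtain ⟨y, rfl⟩ : ∃ y : ℤ_[p], (y : ℚ_[p]) = x := ⟨⟨x, hx⟩, rfl⟩
      have h := PadicInt.norm_sub_zmodRepr_lt_one y
      refine ⟨_, PadicInt.zmodRepr_lt_p y, ?_⟩
      rw [neg_add_eq_sub]
      rw [PadicInt.norm_def, PadicInt.coe_sub, PadicInt.coe_natCast] at h
      exact h
    · rintro ⟨i, -, hi⟩
      have h1 : ‖(i : ℚ_[p])‖ ≤ 1 := by simpa using Padic.norm_int_le_one (p := p) (i : ℤ)
      have := Padic.nonarchimedean (i : ℚ_[p]) (-(i:ℚ_[p]) + x)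
      rw [add_neg_cancel_left] at this
      exact this.trans (max_le h1 hi.le)
  have hm : ∀ i : ℕ, μ {x : ℚ_[p] | ‖-(i:ℚ_[p]) + x‖ < 1} = μ {x : ℚ_[p] | ‖x‖ < 1} := by
    intro i
    exact measure_preimage_add μ (-(i:ℚ_[p])) {x : ℚ_[p] | ‖x‖ < 1}
  rw [hU, measure_biUnion_finset]
  · simp [hm]
  · intro i hi j hj hij
    rw [Function.onFun, Set.disjoint_left]
    intro x hx hx'
    simp only [Set.mem_ofPred_eq] at hx hx'
    apply hij
    have : ‖(((i : ℤ) - (j : ℤ) : ℤ) : ℚ_[p])‖ < 1 := by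
      have := Padic.nonarchimedean (-(j:ℚ_[p]) + x) (-(-(i:ℚ_[p]) + x))
      rw [norm_neg] at this
      refine lt_of_le_of_lt (le_of_eq_of_le ?_ this) (max_lt hx' hx)
      push_cast; congr 1; ring
    rw [Padic.norm_intCast_lt_one_iff] at this
    simp at hi hj
    have := (Int.emod_emod_of_dvd (i:ℤ) (dvd_refl (p:ℤ)))
    have h3 := Int.emod_eq_emod_iff_emod_sub_eq_zero.mpr (Int.emod_eq_zero_of_dvd ‹(p:ℤ) ∣ _›)
    rw [Int.emod_eq_of_lt (by omega) (by omega), Int.emod_eq_of_lt (by omega) (by omega)] at h3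
    omega
  · intro i hi
    exact (isOpen_lt (by fun_prop) continuous_const).measurableSet

open scoped Pointwise in
theorem pcc_char [MeasurableSpace ℚ_[p]] [BorelSpace ℚ_[p]]
    (μ : Measure ℚ_[p]) [μ.IsAddHaarMeasure] (hμ : μ {x : ℚ_[p] | ‖x‖ ≤ 1} = 1)
    (u : ℚ_[p]ˣ) : distribHaarChar ℚ_[p] u = ‖(u : ℚ_[p])‖₊ := by
  have hp0 : (p : ℚ_[p]) ≠ 0 := by exact_mod_cast (Fact.out : p.Prime).ne_zero
  have hpn : ‖(p : ℚ_[p])‖ < 1 := by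
    simpa using Padic.norm_p_lt_one (p := p)
  have h1 : ∀ v : ℚ_[p]ˣ, ‖(v:ℚ_[p])‖ = 1 → distribHaarChar ℚ_[p] v = 1 := by
    intro v hv
    refine distribHaarChar_eq_of_measure_smul_eq_mul (μ := μ) (s := {x : ℚ_[p] | ‖x‖ ≤ 1})
      (by simp [hμ]) (by simp [hμ]) ?_
    rw [ENNReal.coe_one, one_mul]
    congr 1
    ext x
    rw [Set.mem_smul_set_iff_inv_smul_mem]
    simp [Units.smul_def, hv]
  have h2 : distribHaarChar ℚ_[p] (Units.mk0 _ hp0) = ‖(p : ℚ_[p])‖₊ := by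
    refine distribHaarChar_eq_of_measure_smul_eq_mul (μ := μ) (s := {x : ℚ_[p] | ‖x‖ ≤ 1})
      (by simp [hμ]) (by simp [hμ]) ?_
    have : (Units.mk0 _ hp0) • {x : ℚ_[p] | ‖x‖ ≤ 1} = {x : ℚ_[p] | ‖x‖ < 1} := by
      ext x
      rw [Set.mem_smul_set_iff_inv_smul_mem]
      simp only [Units.smul_def, Set.mem_ofPred_eq, Units.val_inv_eq_inv_val, Units.val_mk0,
        smul_eq_mul]
      constructor
      · intro h
        calc ‖x‖ = ‖(p:ℚ_[p])‖ * ‖(p:ℚ_[p])⁻¹ * x‖ := by rw [← norm_mul, mul_inv_cancel_left₀ hp0]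
          _ ≤ ‖(p:ℚ_[p])‖ * 1 := by gcongr
          _ < 1 := by linarith
      · intro h
        obtain ⟨y, hy⟩ := (PadicInt.norm_lt_one_iff_dvd (⟨x, h.le⟩ : ℤ_[p])).1 h
        have : x = (p : ℚ_[p]) * y := by
          have := congrArg (fun z : ℤ_[p] => (z : ℚ_[p])) hy
          simpa using this
        rw [this, inv_mul_cancel_left₀ hp0]
        exact y.2
    rw [this, hμ, mul_one]
    have h3 := pcc_measure_p μ
    rw [hμ] at h3
    have h4 : (‖(p : ℚ_[p])‖₊ : ENNReal) = (p : ENNReal)⁻¹ := by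
      have : ‖(p : ℚ_[p])‖₊ = (p : NNReal)⁻¹ := by
        ext; simp
      rw [this, ENNReal.coe_inv (by exact_mod_cast (Fact.out : p.Prime).ne_zero)]
      simp
    rw [h4]
    exact ENNReal.eq_inv_of_mul_eq_one_left (by rw [mul_comm]; exact h3.symm)
  set P : ℚ_[p]ˣ := Units.mk0 _ hp0 with hP
  have hval : ‖(u:ℚ_[p])‖ = ‖((P ^ (u:ℚ_[p]).valuation : ℚ_[p]ˣ) : ℚ_[p])‖ := by
    rw [Padic.norm_eq_zpow_neg_valuation u.ne_zero]
    simp [hP]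
  have hu : u = (u * (P ^ (u:ℚ_[p]).valuation)⁻¹) * P ^ (u:ℚ_[p]).valuation := by simp
  rw [hu, map_mul, h1, one_mul, map_zpow, h2]
  · rw [← hu]
    ext
    rw [coe_nnnorm, hval]
    simp [hP]
  · rw [Units.val_mul, norm_mul, Units.val_inv_eq_inv_val, norm_inv, ← hval, mul_inv_cancel₀]
    simp

open scoped Pointwise in
theorem pcc_map [MeasurableSpace ℚ_[p]] [BorelSpace ℚ_[p]]
    (μ : Measure ℚ_[p]) [μ.IsAddHaarMeasure] (hμ : μ {x : ℚ_[p] | ‖x‖ ≤ 1} = 1)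
    (a : ℚ_[p]) (ha : a ≠ 0) : μ.map (fun x => a * x) = (‖a‖₊⁻¹ : NNReal) • μ := by
  ext s hs
  rw [Measure.map_apply (by fun_prop) hs]
  have := distribHaarChar_mul μ (Units.mk0 a ha)⁻¹ s
  rw [pcc_char μ hμ] at this
  have h2 : (fun x => a * x) ⁻¹' s = (Units.mk0 a ha)⁻¹ • s := by
    ext x
    rw [Set.mem_smul_set_iff_inv_smul_mem]
    simp [Units.smul_def]
  rw [h2, ← this]
  rw [Measure.smul_apply, ENNReal.smul_def, smul_eq_mul, Units.val_inv_eq_inv_val, nnnorm_inv, Units.val_mk0]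

theorem pcc_integral [MeasurableSpace ℚ_[p]] [BorelSpace ℚ_[p]]
    (μ : Measure ℚ_[p]) [μ.IsAddHaarMeasure] (hμ : μ {x : ℚ_[p] | ‖x‖ ≤ 1} = 1)
    (a : ℚ_[p]) (ha : a ≠ 0) (f : ℚ_[p] → ℂ) :
    ∫ x, f (a * x) ∂μ = ((‖a‖⁻¹ : ℝ) : ℂ) * ∫ x, f x ∂μ := by
  have he : MeasurableEmbedding (fun x => a * x) := measurableEmbedding_mulLeft₀ ha
  rw [← he.integral_map (μ := μ) f, pcc_map μ hμ a ha, integral_smul_nnreal_measure]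
  rw [NNReal.smul_def]; simp

theorem pcc_measure_ball [MeasurableSpace ℚ_[p]] [BorelSpace ℚ_[p]]
    (μ : Measure ℚ_[p]) [μ.IsAddHaarMeasure] (hμ : μ {x : ℚ_[p] | ‖x‖ ≤ 1} = 1)
    (a : ℚ_[p]) (ha : a ≠ 0) : μ {x : ℚ_[p] | ‖x‖ ≤ ‖a‖} = ‖a‖₊ := by
  have h := congrArg (fun ν : Measure ℚ_[p] => ν {x : ℚ_[p] | ‖x‖ ≤ 1}) (pcc_map μ hμ a⁻¹ (inv_ne_zero ha))
  have hs : MeasurableSet {x : ℚ_[p] | ‖x‖ ≤ 1} := (isClosed_le (by fun_prop) continuous_const).measurableSet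
  rw [Measure.map_apply (by fun_prop) hs, Measure.smul_apply, hμ] at h
  convert h using 1
  · congr 1
    ext x
    simp [norm_mul, inv_mul_le_iff₀ (norm_pos_iff.2 ha)]
  · simp [ENNReal.smul_def]

theorem pcc_meas_ball [MeasurableSpace ℚ_[p]] [BorelSpace ℚ_[p]] (r : ℝ) :
    MeasurableSet {x : ℚ_[p] | ‖x‖ ≤ r} :=
  (isClosed_le (by fun_prop) continuous_const).measurableSet

theorem pcc_int_char [MeasurableSpace ℚ_[p]] [BorelSpace ℚ_[p]]
    (μ : Measure ℚ_[p]) (e : AddChar ℚ_[p] Circle) (he : Continuous e)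
    (f : ℚ_[p] → ℂ) (hf : Integrable f μ) (g : ℚ_[p] → ℚ_[p]) (hg : Continuous g) :
    Integrable (fun x => f x * (e (g x) : ℂ)) μ := by
  refine hf.mono (hf.1.mul ?_) ?_
  · exact (Continuous.aestronglyMeasurable (by fun_prop))
  · refine Filter.Eventually.of_forall fun x => ?_
    rw [norm_mul, Circle.norm_coe, mul_one]

/-- Vanishing of oscillating integrals by translation invariance. -/
theorem pcc_vanish [MeasurableSpace ℚ_[p]] [BorelSpace ℚ_[p]]
    (μ : Measure ℚ_[p]) [μ.IsAddHaarMeasure] (e : AddChar ℚ_[p] Circle)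
    (f : ℚ_[p] → ℂ) (y x : ℚ_[p]) (hx : e (y * x) ≠ 1) (hf : ∀ z, f (z + x) = f z) :
    ∫ z, f z * (e (y * z) : ℂ) ∂μ = 0 := by
  have h := integral_add_right_eq_self (μ := μ) (fun z => f z * (e (y * z) : ℂ)) x
  simp only [hf, mul_add, AddChar.map_add_eq_mul, Circle.coe_mul, ← mul_assoc] at h
  rw [integral_mul_const] at h
  have h1 : (e (y * x) : ℂ) ≠ 1 := by
    intro h2
    exact hx (Circle.ext (by simpa using h2))
  have h2 : (∫ z, f z * (e (y * z) : ℂ) ∂μ) * ((e (y * x) : ℂ) - 1) = 0 := by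
    rw [mul_sub, h]; ring
  exact (mul_eq_zero.1 h2).resolve_right (sub_ne_zero.2 h1)

theorem pcc_ultra (x y : ℚ_[p]) (r : ℝ) (hy : ‖y‖ ≤ r) : ‖x + y‖ ≤ r ↔ ‖x‖ ≤ r := by
  constructor
  · intro h
    have := Padic.nonarchimedean (x + y) (-y)
    rw [add_neg_cancel_right, norm_neg] at this
    exact this.trans (max_le h hy)
  · intro h
    exact (Padic.nonarchimedean x y).trans (max_le h hy)

theorem pcc_norm_ge (y : ℚ_[p]) (hy : 1 < ‖y‖) : (p : ℝ) ≤ ‖y‖ := by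
  by_contra h
  push Not at h
  have := (Padic.norm_le_pow_iff_norm_lt_pow_add_one y 0).2 (by simpa using h)
  simp at this
  linarith

theorem pcc_e_one (e : AddChar ℚ_[p] Circle) (he1 : ∀ x : ℤ_[p], e (x : ℚ_[p]) = 1)
    (x : ℚ_[p]) (hx : ‖x‖ ≤ 1) : e x = 1 := he1 ⟨x, hx⟩

theorem pcc_A [MeasurableSpace ℚ_[p]] [BorelSpace ℚ_[p]]
    (μ : Measure ℚ_[p]) [μ.IsAddHaarMeasure] (hμ : μ {x : ℚ_[p] | ‖x‖ ≤ 1} = 1)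
    (e : AddChar ℚ_[p] Circle)
    (he1 : ∀ x : ℤ_[p], e (x : ℚ_[p]) = 1)
    (he2 : ∃ x : ℚ_[p], ‖x‖ ≤ p ∧ e x ≠ 1) (y : ℚ_[p]) :
    ∫ x, (if ‖x‖ ≤ 1 then (1:ℂ) else 0) * (e (y * x) : ℂ) ∂μ = if ‖y‖ ≤ 1 then 1 else 0 := by
  split_ifs with hy
  · have : ∀ x : ℚ_[p], (if ‖x‖ ≤ 1 then (1:ℂ) else 0) * (e (y * x) : ℂ) =
        Set.indicator {x : ℚ_[p] | ‖x‖ ≤ 1} (fun _ => (1:ℂ)) x := by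
      intro x
      by_cases hx : ‖x‖ ≤ 1
      · rw [pcc_e_one e he1 (y * x) (by rw [norm_mul]; exact mul_le_one₀ hy (norm_nonneg _) hx)]
        simp [hx]
      · simp [hx]
    simp_rw [this]
    rw [integral_indicator (pcc_meas_ball 1)]
    simp [Measure.real, hμ]
  · push Not at hy
    obtain ⟨x0, hx0, hx1⟩ := he2
    have hy0 : y ≠ 0 := by rintro rfl; simp at hy; linarith
    refine pcc_vanish μ e _ y (y⁻¹ * x0) (by rwa [mul_inv_cancel_left₀ hy0]) ?_
    intro z
    have : ‖y⁻¹ * x0‖ ≤ 1 := by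
      rw [norm_mul, norm_inv, inv_mul_le_iff₀ (by linarith), mul_one]
      exact hx0.trans (pcc_norm_ge y hy)
    simp only [pcc_ultra z _ 1 this]

theorem pcc_log_int1 [MeasurableSpace ℚ_[p]] [BorelSpace ℚ_[p]]
    (μ : Measure ℚ_[p]) [μ.IsAddHaarMeasure] (hμ : μ {x : ℚ_[p] | ‖x‖ ≤ 1} = 1) :
    Integrable (Set.indicator {x : ℚ_[p] | ‖x‖ ≤ 1} (fun ξ : ℚ_[p] => (Real.log ‖ξ‖ : ℂ))) μ := by
  have hp0 : (p : ℚ_[p]) ≠ 0 := by exact_mod_cast (Fact.out : p.Prime).ne_zero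
  have hm : Measurable (fun ξ : ℚ_[p] => (Real.log ‖ξ‖ : ℂ)) := by fun_prop
  refine ⟨(hm.indicator (pcc_meas_ball 1)).aestronglyMeasurable, ?_⟩
  rw [hasFiniteIntegral_iff_enorm]
  have hb : ∀ ξ : ℚ_[p], ‖Set.indicator {x : ℚ_[p] | ‖x‖ ≤ 1}
      (fun ξ : ℚ_[p] => (Real.log ‖ξ‖ : ℂ)) ξ‖ₑ ≤
      ∑' k : ℕ, Set.indicator {x : ℚ_[p] | ‖x‖ ≤ ‖(p : ℚ_[p]) ^ k‖}
        (fun _ => ENNReal.ofReal (Real.log p)) ξ := by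
    intro ξ
    by_cases hξ : ξ = 0
    · subst hξ; simp
    by_cases h1 : ‖ξ‖ ≤ 1
    · rw [Set.indicator_of_mem (by exact h1)]
      obtain ⟨y, rfl⟩ : ∃ y : ℤ_[p], (y : ℚ_[p]) = ξ := ⟨⟨ξ, h1⟩, rfl⟩
      have hy : y ≠ 0 := by rintro rfl; simp at hξ
      have hn : ‖(y : ℚ_[p])‖ = ((p : ℝ) ^ y.valuation)⁻¹ := by
        have := PadicInt.norm_eq_zpow_neg_valuation hy
        rw [PadicInt.norm_def] at this
        rw [this]; simp
      refine le_trans ?_ (ENNReal.sum_le_tsum (Finset.range y.valuation))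
      have : ∀ k ∈ Finset.range y.valuation, Set.indicator {x : ℚ_[p] | ‖x‖ ≤ ‖(p : ℚ_[p]) ^ k‖}
        (fun _ => ENNReal.ofReal (Real.log p)) (y : ℚ_[p]) = ENNReal.ofReal (Real.log p) := by
        intro k hk
        rw [Set.indicator_of_mem]
        change ‖(y : ℚ_[p])‖ ≤ ‖(p : ℚ_[p]) ^ k‖
        rw [hn, norm_pow, Padic.norm_p, inv_pow]
        have : (1:ℝ) ≤ p := by exact_mod_cast (Fact.out : p.Prime).one_lt.le
        gcongr
        simp at hk; omega
      rw [Finset.sum_congr rfl this, hn, Real.log_inv, Real.log_pow]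
      rw [← ofReal_norm]
      simp only [Finset.sum_const, Finset.card_range, nsmul_eq_mul]
      have hl : 0 ≤ Real.log p := Real.log_natCast_nonneg p
      rw [Complex.norm_real, norm_neg, Real.norm_of_nonneg (by positivity),
        ENNReal.ofReal_mul (by positivity)]
      simp
    · rw [Set.indicator_of_notMem (by exact h1)]; simp
  refine lt_of_le_of_lt (lintegral_mono hb) ?_
  rw [lintegral_tsum]
  · have : ∀ k : ℕ, ∫⁻ ξ, Set.indicator {x : ℚ_[p] | ‖x‖ ≤ ‖(p : ℚ_[p]) ^ k‖}
        (fun _ => ENNReal.ofReal (Real.log p)) ξ ∂μ =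
        ENNReal.ofReal (Real.log p) * (‖(p : ℚ_[p])‖₊ : ENNReal) ^ k := by
      intro k
      rw [lintegral_indicator_const (pcc_meas_ball _), pcc_measure_ball μ hμ _ (pow_ne_zero _ hp0)]
      simp
    simp_rw [this]
    rw [ENNReal.tsum_mul_left, ENNReal.tsum_geometric]
    refine ENNReal.mul_lt_top (by simp) ?_
    rw [ENNReal.inv_lt_top, tsub_pos_iff_lt]
    have : ‖(p : ℚ_[p])‖ < 1 := Padic.norm_p_lt_one
    exact_mod_cast this
  · intro k
    exact (measurable_const.indicator (pcc_meas_ball _)).aemeasurable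

theorem pcc_log_ae [MeasurableSpace ℚ_[p]] [BorelSpace ℚ_[p]]
    (μ : Measure ℚ_[p]) [μ.IsAddHaarMeasure] :
    ∀ᵐ x ∂μ, x ≠ (0:ℚ_[p]) := by
  have : μ {(0:ℚ_[p])} = 0 := measure_singleton 0
  exact compl_mem_ae_iff.2 this

theorem pcc_log_int [MeasurableSpace ℚ_[p]] [BorelSpace ℚ_[p]]
    (μ : Measure ℚ_[p]) [μ.IsAddHaarMeasure] (hμ : μ {x : ℚ_[p] | ‖x‖ ≤ 1} = 1)
    (a : ℚ_[p]) (ha : a ≠ 0) :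
    Integrable (fun ξ : ℚ_[p] => if ‖ξ‖ ≤ ‖a‖ then (Real.log ‖ξ‖ : ℂ) else 0) μ := by
  have he : MeasurableEmbedding (fun x => a⁻¹ * x) := measurableEmbedding_mulLeft₀ (inv_ne_zero ha)
  have h1 := pcc_log_int1 μ hμ
  have h2 : Integrable (Set.indicator {x : ℚ_[p] | ‖x‖ ≤ 1}
    (fun ξ : ℚ_[p] => (Real.log ‖ξ‖ : ℂ))) (μ.map (fun x => a⁻¹ * x)) := by
    rw [pcc_map μ hμ _ (inv_ne_zero ha)]
    exact h1.smul_measure_nnreal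
  rw [he.integrable_map_iff] at h2
  have h3 : Integrable (Set.indicator {x : ℚ_[p] | ‖x‖ ≤ ‖a‖} (fun _ => (Real.log ‖a‖ : ℂ))) μ := by
    rw [integrable_indicator_iff (pcc_meas_ball _)]
    refine integrableOn_const ?_
    rw [pcc_measure_ball μ hμ a ha]; simp
  refine (h2.add h3).congr ?_
  filter_upwards [pcc_log_ae μ] with x hx
  have h4 : ‖a⁻¹ * x‖ ≤ 1 ↔ ‖x‖ ≤ ‖a‖ := by
    rw [norm_mul, norm_inv, inv_mul_le_iff₀ (norm_pos_iff.2 ha), mul_one]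
  by_cases h : ‖x‖ ≤ ‖a‖
  · have h5 := h4.2 h
    simp only [Pi.add_apply, Function.comp]
    rw [Set.indicator_of_mem (by exact h5), Set.indicator_of_mem (by exact h), if_pos h, norm_mul,
      norm_inv, Real.log_mul (by simpa using ha) (by simpa using hx), Real.log_inv]
    push_cast; ring
  · have h5 := mt h4.1 h
    simp only [Pi.add_apply, Function.comp]
    rw [Set.indicator_of_notMem (by exact h5), Set.indicator_of_notMem (by exact h), if_neg h]
    simp

/-- `G(u) = ∫_{ℤ_p} log|η| e(uη) dη`. -/
noncomputable def pccG [MeasurableSpace ℚ_[p]] (μ : Measure ℚ_[p])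
    (e : AddChar ℚ_[p] Circle) (u : ℚ_[p]) : ℂ :=
  ∫ η, (if ‖η‖ ≤ 1 then (Real.log ‖η‖ : ℂ) else 0) * (e (u * η) : ℂ) ∂μ

/-- Shifting the scale of the logarithm in an oscillating integral. -/
theorem pcc_shift [MeasurableSpace ℚ_[p]] [BorelSpace ℚ_[p]]
    (μ : Measure ℚ_[p]) [μ.IsAddHaarMeasure] (hμ : μ {x : ℚ_[p] | ‖x‖ ≤ 1} = 1)
    (e : AddChar ℚ_[p] Circle) (he : Continuous e)
    (he1 : ∀ x : ℤ_[p], e (x : ℚ_[p]) = 1)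
    (he2 : ∃ x : ℚ_[p], ‖x‖ ≤ p ∧ e x ≠ 1) (u c : ℚ_[p]) (hc : c ≠ 0) :
    ∫ η, (if ‖η‖ ≤ 1 then (Real.log ‖c * η‖ : ℂ) else 0) * (e (u * η) : ℂ) ∂μ =
      pccG μ e u + (Real.log ‖c‖ : ℂ) * (if ‖u‖ ≤ 1 then 1 else 0) := by
  rw [← pcc_A μ hμ e he1 he2 u, ← integral_const_mul, pccG, ← integral_add]
  · refine integral_congr_ae ?_
    filter_upwards [pcc_log_ae μ] with x hx
    split_ifs
    · rw [norm_mul, Real.log_mul (by simpa using hc) (by simpa using hx)]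
      push_cast; ring
    · simp
  · refine pcc_int_char μ e he _ ?_ (fun x => u * x) (by fun_prop)
    simpa using pcc_log_int μ hμ 1 one_ne_zero
  · refine Integrable.const_mul (pcc_int_char μ e he _ ?_ (fun x => u * x) (by fun_prop)) _
    have : Integrable (Set.indicator {x : ℚ_[p] | ‖x‖ ≤ 1} (fun _ => (1 : ℂ))) μ := by
      rw [integrable_indicator_iff (pcc_meas_ball _)]
      exact integrableOn_const (by simp [hμ])
    exact this

theorem pcc_G_eq [MeasurableSpace ℚ_[p]] [BorelSpace ℚ_[p]]
    (μ : Measure ℚ_[p]) [μ.IsAddHaarMeasure] (hμ : μ {x : ℚ_[p] | ‖x‖ ≤ 1} = 1)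
    (e : AddChar ℚ_[p] Circle) (he : Continuous e)
    (he1 : ∀ x : ℤ_[p], e (x : ℚ_[p]) = 1)
    (he2 : ∃ x : ℚ_[p], ‖x‖ ≤ p ∧ e x ≠ 1) :
    ∃ K D : ℂ, ∀ u : ℚ_[p], pccG μ e u = if ‖u‖ ≤ 1 then K else ((‖u‖⁻¹ : ℝ) : ℂ) * D := by
  have hp0 : (p : ℚ_[p]) ≠ 0 := by exact_mod_cast (Fact.out : p.Prime).ne_zero
  have hpn : ‖(p : ℚ_[p])⁻¹‖ = p := by simp
  refine ⟨pccG μ e 0, ∫ η, (if ‖η‖ ≤ ‖(p : ℚ_[p])⁻¹‖ then (Real.log ‖η‖ : ℂ) else 0) *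
    (e (1 * η) : ℂ) ∂μ, fun u => ?_⟩
  split_ifs with hu
  · unfold pccG
    congr 1
    ext η
    split_ifs with hη
    · rw [pcc_e_one e he1 (u * η) (by rw [norm_mul]; exact mul_le_one₀ hu (norm_nonneg _) hη)]
      simp
    · simp
  · have hu' := hu
    push Not at hu'
    have hu0 : u ≠ 0 := by rintro rfl; simp at hu
    have h1 := pcc_shift μ hμ e he he1 he2 u u hu0
    rw [if_neg hu, mul_zero, add_zero] at h1
    rw [← h1]
    have h2 := pcc_integral μ hμ u hu0 (fun η => (if ‖η‖ ≤ ‖u‖ then (Real.log ‖η‖ : ℂ) else 0) *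
      (e (1 * η) : ℂ))
    have h3 : ∀ η : ℚ_[p], ‖u * η‖ ≤ ‖u‖ ↔ ‖η‖ ≤ 1 := by
      intro η
      rw [norm_mul, mul_le_iff_le_one_right (norm_pos_iff.2 hu0)]
    simp only [h3, one_mul] at h2
    rw [h2]
    congr 1
    rw [← sub_eq_zero]
    have hi := fun (a : ℚ_[p]) (ha : a ≠ 0) =>
      pcc_int_char μ e he _ (pcc_log_int μ hμ a ha) (fun x => 1 * x) (by fun_prop)
    simp only [one_mul] at hi ⊢
    rw [← integral_sub (hi u hu0) (hi _ (inv_ne_zero hp0))]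
    obtain ⟨x0, hx0, hx1⟩ := he2
    have hv := pcc_vanish μ e (fun η => (if ‖η‖ ≤ ‖u‖ then (Real.log ‖η‖ : ℂ) else 0) -
      (if ‖η‖ ≤ ‖(p : ℚ_[p])⁻¹‖ then (Real.log ‖η‖ : ℂ) else 0)) 1 x0 (by simpa using hx1) ?_
    · simpa only [one_mul, sub_mul] using hv
    · intro z
      have hpu := pcc_norm_ge u hu'
      simp only [pcc_ultra z x0 _ (hx0.trans hpu), hpn, pcc_ultra z x0 _ hx0]
      by_cases hz : ‖z‖ ≤ p
      · simp [hz, hz.trans hpu]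
      · push Not at hz
        rw [Padic.add_eq_max_of_ne (by linarith), max_eq_left (by linarith)]

/-- The indicator function of the ball with centre `a` and radius `‖l‖`. -/
noncomputable def pccInd (a l : ℚ_[p]) (s : ℚ_[p]) : ℂ := if ‖s - a‖ ≤ ‖l‖ then 1 else 0

theorem pcc_FT [MeasurableSpace ℚ_[p]] [BorelSpace ℚ_[p]]
    (μ : Measure ℚ_[p]) [μ.IsAddHaarMeasure] (hμ : μ {x : ℚ_[p] | ‖x‖ ≤ 1} = 1)
    (e : AddChar ℚ_[p] Circle)
    (he1 : ∀ x : ℤ_[p], e (x : ℚ_[p]) = 1)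
    (he2 : ∃ x : ℚ_[p], ‖x‖ ≤ p ∧ e x ≠ 1) (a l : ℚ_[p]) (hl : l ≠ 0) (ξ : ℚ_[p]) :
    padicFourierInv μ e (pccInd a l) ξ =
      (if ‖l * ξ‖ ≤ 1 then (‖l‖ : ℂ) else 0) * (e (-(ξ * a)) : ℂ) := by
  unfold padicFourierInv
  rw [← integral_add_right_eq_self (μ := μ) _ a]
  have h2 := pcc_integral μ hμ l hl (fun x => pccInd a l (x + a) * (e (-(ξ * (x + a))) : ℂ))
  have hl' : (‖l‖ : ℂ) ≠ 0 := by simpa using hl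
  have h3 : ∫ x, pccInd a l (x + a) * (e (-(ξ * (x + a))) : ℂ) ∂μ = (‖l‖ : ℂ) *
      ∫ x, pccInd a l (l * x + a) * (e (-(ξ * (l * x + a))) : ℂ) ∂μ := by
    rw [h2, ← mul_assoc, Complex.ofReal_inv, mul_inv_cancel₀ hl', one_mul]
  rw [h3]
  have h4 : ∀ x, pccInd a l (l * x + a) * (e (-(ξ * (l * x + a))) : ℂ) =
      (if ‖x‖ ≤ 1 then (1 : ℂ) else 0) * (e (-(l * ξ) * x) : ℂ) * (e (-(ξ * a)) : ℂ) := by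
    intro x
    unfold pccInd
    have h5 : ‖l * x + a - a‖ ≤ ‖l‖ ↔ ‖x‖ ≤ 1 := by
      rw [add_sub_cancel_right, norm_mul, mul_le_iff_le_one_right (norm_pos_iff.2 hl)]
    have h6 : -(ξ * (l * x + a)) = -(l * ξ) * x + -(ξ * a) := by ring
    simp only [h5]
    rw [mul_assoc, h6, AddChar.map_add_eq_mul, Circle.coe_mul]
  simp_rw [h4]
  rw [integral_mul_const, pcc_A μ hμ e he1 he2, norm_neg]
  split_ifs <;> ring

/-- The functions for which everything converges. -/
def pccGood [MeasurableSpace ℚ_[p]] (μ : Measure ℚ_[p])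
    (e : AddChar ℚ_[p] Circle) (φ : ℚ_[p] → ℂ) : Prop :=
  Integrable φ μ ∧ Integrable (fun ξ => (Real.log ‖ξ‖ : ℂ) * padicFourierInv μ e φ ξ) μ

theorem pcc_Ind_good [MeasurableSpace ℚ_[p]] [BorelSpace ℚ_[p]]
    (μ : Measure ℚ_[p]) [μ.IsAddHaarMeasure] (hμ : μ {x : ℚ_[p] | ‖x‖ ≤ 1} = 1)
    (e : AddChar ℚ_[p] Circle) (he : Continuous e)
    (he1 : ∀ x : ℤ_[p], e (x : ℚ_[p]) = 1)
    (he2 : ∃ x : ℚ_[p], ‖x‖ ≤ p ∧ e x ≠ 1) (a l : ℚ_[p]) (hl : l ≠ 0) :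
    pccGood μ e (pccInd a l) := by
  constructor
  · have : Integrable (Set.indicator {x : ℚ_[p] | ‖x‖ ≤ ‖l‖} (fun _ => (1 : ℂ))) μ := by
      rw [integrable_indicator_iff (pcc_meas_ball _)]
      exact integrableOn_const (by simp [pcc_measure_ball μ hμ l hl])
    exact this.comp_sub_right a
  · have h1 := (pcc_log_int μ hμ l⁻¹ (inv_ne_zero hl)).const_mul (‖l‖ : ℂ)
    have h2 := pcc_int_char μ e he _ h1 (fun ξ => -(ξ * a)) (by fun_prop)
    refine h2.congr (Filter.Eventually.of_forall fun ξ => ?_)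
    dsimp only
    rw [pcc_FT μ hμ e he1 he2 a l hl]
    have : ‖l * ξ‖ ≤ 1 ↔ ‖ξ‖ ≤ ‖l⁻¹‖ := by
      rw [norm_mul, norm_inv, inv_eq_one_div, le_div_iff₀ (norm_pos_iff.2 hl), mul_comm]
    simp only [this]
    split_ifs <;> ring

theorem pcc_H_Ind [MeasurableSpace ℚ_[p]] [BorelSpace ℚ_[p]]
    (μ : Measure ℚ_[p]) [μ.IsAddHaarMeasure] (hμ : μ {x : ℚ_[p] | ‖x‖ ≤ 1} = 1)
    (e : AddChar ℚ_[p] Circle) (he : Continuous e)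
    (he1 : ∀ x : ℤ_[p], e (x : ℚ_[p]) = 1)
    (he2 : ∃ x : ℚ_[p], ‖x‖ ≤ p ∧ e x ≠ 1) (a l : ℚ_[p]) (hl : l ≠ 0) (t : ℚ_[p]) :
    padicCondOp μ e (pccInd a l) t = (Real.log ‖t‖ : ℂ) * pccInd a l t +
      (pccG μ e ((t - a) * l⁻¹) - (Real.log ‖l‖ : ℂ) * pccInd a l t) := by
  unfold padicCondOp
  congr 1
  simp_rw [pcc_FT μ hμ e he1 he2 a l hl]
  have h2 := pcc_integral μ hμ l hl (fun η => (‖l‖ : ℂ) *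
    ((if ‖η‖ ≤ 1 then (Real.log ‖l⁻¹ * η‖ : ℂ) else 0) * (e (((t - a) * l⁻¹) * η) : ℂ)))
  rw [integral_const_mul (μ := μ) (‖l‖ : ℂ) (fun η => (if ‖η‖ ≤ 1 then (Real.log ‖l⁻¹ * η‖ : ℂ) else 0) * (e (((t - a) * l⁻¹) * η) : ℂ)),
    pcc_shift μ hμ e he he1 he2 _ _ (inv_ne_zero hl)] at h2
  have h3 : ‖(t - a) * l⁻¹‖ ≤ 1 ↔ ‖t - a‖ ≤ ‖l‖ := by
    rw [norm_mul, norm_inv, mul_inv_le_iff₀ (norm_pos_iff.2 hl), one_mul]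
  simp only [h3] at h2
  have hl' : (‖l‖ : ℂ) ≠ 0 := by simpa using hl
  trans
  swap
  · trans
    · exact h2
    · rw [norm_inv, Real.log_inv]
      unfold pccInd
      push_cast
      field_simp
      ring
  · congr 1
    ext ξ
    rw [inv_mul_cancel_left₀ hl]
    have : (e ((t - a) * l⁻¹ * (l * ξ)) : ℂ) = (e (-(ξ * a)) : ℂ) * (e (t * ξ) : ℂ) := by
      rw [← Circle.coe_mul, ← AddChar.map_add_eq_mul]
      congr 2
      field_simp
      ring
    rw [this]
    split_ifs <;> ring

/-- The inversion operator. -/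
noncomputable def pccI (φ : ℚ_[p] → ℂ) : ℚ_[p] → ℂ :=
  fun s => if s = 0 then 0 else ((‖s‖⁻¹ : ℝ) : ℂ) * φ s⁻¹

theorem pcc_FT_add [MeasurableSpace ℚ_[p]] [BorelSpace ℚ_[p]]
    (μ : Measure ℚ_[p]) (e : AddChar ℚ_[p] Circle) (he : Continuous e) (f g : ℚ_[p] → ℂ)
    (hf : Integrable f μ) (hg : Integrable g μ) (ξ : ℚ_[p]) :
    padicFourierInv μ e (fun x => f x + g x) ξ =
      padicFourierInv μ e f ξ + padicFourierInv μ e g ξ := by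
  unfold padicFourierInv
  simp only [add_mul]
  exact integral_add (pcc_int_char μ e he f hf _ (by fun_prop))
    (pcc_int_char μ e he g hg _ (by fun_prop))

theorem pcc_FT_smul [MeasurableSpace ℚ_[p]]
    (μ : Measure ℚ_[p]) (e : AddChar ℚ_[p] Circle) (c : ℂ) (f : ℚ_[p] → ℂ) (ξ : ℚ_[p]) :
    padicFourierInv μ e (fun x => c * f x) ξ = c * padicFourierInv μ e f ξ := by
  unfold padicFourierInv
  simp only [mul_assoc]
  exact integral_const_mul _ _

theorem pcc_good_add [MeasurableSpace ℚ_[p]] [BorelSpace ℚ_[p]]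
    (μ : Measure ℚ_[p]) (e : AddChar ℚ_[p] Circle) (he : Continuous e) (f g : ℚ_[p] → ℂ)
    (hf : pccGood μ e f) (hg : pccGood μ e g) : pccGood μ e (fun x => f x + g x) := by
  refine ⟨hf.1.add hg.1, ?_⟩
  simp only [pcc_FT_add μ e he f g hf.1 hg.1, mul_add]
  exact hf.2.add hg.2

theorem pcc_good_smul [MeasurableSpace ℚ_[p]]
    (μ : Measure ℚ_[p]) (e : AddChar ℚ_[p] Circle) (c : ℂ) (f : ℚ_[p] → ℂ)
    (hf : pccGood μ e f) : pccGood μ e (fun x => c * f x) := by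
  refine ⟨hf.1.const_mul c, ?_⟩
  simp only [pcc_FT_smul μ e]
  exact (hf.2.const_mul c).congr (Filter.Eventually.of_forall fun x => by dsimp only; ring)

theorem pcc_H_add [MeasurableSpace ℚ_[p]] [BorelSpace ℚ_[p]]
    (μ : Measure ℚ_[p]) (e : AddChar ℚ_[p] Circle) (he : Continuous e) (f g : ℚ_[p] → ℂ)
    (hf : pccGood μ e f) (hg : pccGood μ e g) (t : ℚ_[p]) :
    padicCondOp μ e (fun x => f x + g x) t = padicCondOp μ e f t + padicCondOp μ e g t := by
  unfold padicCondOp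
  simp only [pcc_FT_add μ e he f g hf.1 hg.1, mul_add, add_mul]
  rw [integral_add (pcc_int_char μ e he _ hf.2 _ (by fun_prop))
    (pcc_int_char μ e he _ hg.2 _ (by fun_prop))]
  ring

theorem pcc_H_smul [MeasurableSpace ℚ_[p]]
    (μ : Measure ℚ_[p]) (e : AddChar ℚ_[p] Circle) (c : ℂ) (f : ℚ_[p] → ℂ) (t : ℚ_[p]) :
    padicCondOp μ e (fun x => c * f x) t = c * padicCondOp μ e f t := by
  unfold padicCondOp
  simp only [pcc_FT_smul μ e]
  rw [mul_add, ← integral_const_mul]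
  congr 1
  · ring
  · congr 1; ext ξ; ring

/-- The property proved by decomposition into balls. -/
def pccP [MeasurableSpace ℚ_[p]] (μ : Measure ℚ_[p])
    (e : AddChar ℚ_[p] Circle) (φ : ℚ_[p] → ℂ) : Prop :=
  pccGood μ e φ ∧ pccGood μ e (pccI φ) ∧
    ∀ t : ℚ_[p], t ≠ 0 → padicCondOp μ e (pccI φ) t = ((‖t‖⁻¹ : ℝ) : ℂ) * padicCondOp μ e φ t⁻¹

theorem pcc_P_add [MeasurableSpace ℚ_[p]] [BorelSpace ℚ_[p]]
    (μ : Measure ℚ_[p]) (e : AddChar ℚ_[p] Circle) (he : Continuous e) (f g : ℚ_[p] → ℂ)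
    (hf : pccP μ e f) (hg : pccP μ e g) : pccP μ e (fun x => f x + g x) := by
  have h : pccI (fun x => f x + g x) = fun x => pccI f x + pccI g x := by
    ext x; unfold pccI; split_ifs <;> ring
  unfold pccP
  rw [h]
  refine ⟨pcc_good_add μ e he _ _ hf.1 hg.1, pcc_good_add μ e he _ _ hf.2.1 hg.2.1, ?_⟩
  intro t ht
  rw [pcc_H_add μ e he _ _ hf.1 hg.1, pcc_H_add μ e he _ _ hf.2.1 hg.2.1, hf.2.2 t ht, hg.2.2 t ht]
  ring

theorem pcc_P_smul [MeasurableSpace ℚ_[p]]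
    (μ : Measure ℚ_[p]) (e : AddChar ℚ_[p] Circle) (c : ℂ) (f : ℚ_[p] → ℂ)
    (hf : pccP μ e f) : pccP μ e (fun x => c * f x) := by
  have h : pccI (fun x => c * f x) = fun x => c * pccI f x := by
    ext x; unfold pccI; split_ifs <;> ring
  unfold pccP
  rw [h]
  refine ⟨pcc_good_smul μ e _ _ hf.1, pcc_good_smul μ e _ _ hf.2.1, ?_⟩
  intro t ht
  rw [pcc_H_smul, pcc_H_smul, hf.2.2 t ht]
  ring

/-- On a ball around `a` avoiding `0` the norm is constant. -/
theorem pcc_norm_eq (a s : ℚ_[p]) (r : ℝ) (hr : r < ‖a‖) (h : ‖s - a‖ ≤ r) : ‖s‖ = ‖a‖ := by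
  have h1 : ‖s - a‖ < ‖a‖ := lt_of_le_of_lt h hr
  have := Padic.add_eq_max_of_ne (q := s - a) (r := a) h1.ne
  rw [sub_add_cancel, max_eq_right h1.le] at this
  exact this

theorem pcc_inv_ball (a l s : ℚ_[p]) (hla : ‖l‖ < ‖a‖) (hs : s ≠ 0) :
    ‖s⁻¹ - a‖ ≤ ‖l‖ ↔ ‖s - a⁻¹‖ ≤ ‖l * (a⁻¹ * a⁻¹)‖ := by
  have hapos : 0 < ‖a‖ := lt_of_le_of_lt (norm_nonneg _) hla
  have ha : a ≠ 0 := norm_pos_iff.1 hapos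
  have hspos : 0 < ‖s‖ := norm_pos_iff.2 hs
  have h1 : s⁻¹ - a = -(a * s⁻¹ * (s - a⁻¹)) := by field_simp; ring
  have hkey : ‖s‖ = ‖a‖⁻¹ → (‖s⁻¹ - a‖ ≤ ‖l‖ ↔ ‖s - a⁻¹‖ ≤ ‖l * (a⁻¹ * a⁻¹)‖) := by
    intro h
    rw [h1, norm_neg, norm_mul, norm_mul, norm_inv, h, inv_inv, norm_mul, norm_mul, norm_inv,
      ← mul_inv, ← div_eq_mul_inv, le_div_iff₀ (by positivity), mul_comm]
  constructor
  · intro h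
    have := pcc_norm_eq a s⁻¹ _ hla h
    rw [norm_inv, inv_eq_iff_eq_inv] at this
    exact (hkey this).1 h
  · intro h
    have h2 : ‖l * (a⁻¹ * a⁻¹)‖ < ‖a⁻¹‖ := by
      rw [norm_mul, norm_mul, norm_inv, ← mul_assoc]
      have : ‖l‖ * ‖a‖⁻¹ < 1 := by rw [← div_eq_mul_inv, div_lt_one hapos]; exact hla
      exact mul_lt_of_lt_one_left (by positivity) this
    have := pcc_norm_eq _ _ _ h2 h
    rw [norm_inv] at this
    exact (hkey this).2 h

theorem pcc_I_Ind (a l : ℚ_[p]) (hla : ‖l‖ < ‖a‖) :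
    pccI (pccInd a l) = fun s => (‖a‖ : ℂ) * pccInd a⁻¹ (l * (a⁻¹ * a⁻¹)) s := by
  have hapos : 0 < ‖a‖ := lt_of_le_of_lt (norm_nonneg _) hla
  ext s
  unfold pccI pccInd
  by_cases hs : s = 0
  · have h2 : ‖l * (a⁻¹ * a⁻¹)‖ < ‖a⁻¹‖ := by
      rw [norm_mul, norm_mul, norm_inv, ← mul_assoc]
      have : ‖l‖ * ‖a‖⁻¹ < 1 := by rw [← div_eq_mul_inv, div_lt_one hapos]; exact hla
      exact mul_lt_of_lt_one_left (by positivity) this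
    rw [if_pos hs, if_neg, mul_zero]
    rw [hs, zero_sub, norm_neg]
    exact not_le.2 h2
  · rw [if_neg hs]
    simp only [← pcc_inv_ball a l s hla hs]
    split_ifs with h
    · have := pcc_norm_eq a s⁻¹ _ hla h
      rw [norm_inv] at this
      rw [this]
    · simp

theorem pcc_P_Ind [MeasurableSpace ℚ_[p]] [BorelSpace ℚ_[p]]
    (μ : Measure ℚ_[p]) [μ.IsAddHaarMeasure] (hμ : μ {x : ℚ_[p] | ‖x‖ ≤ 1} = 1)
    (e : AddChar ℚ_[p] Circle) (he : Continuous e)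
    (he1 : ∀ x : ℤ_[p], e (x : ℚ_[p]) = 1)
    (he2 : ∃ x : ℚ_[p], ‖x‖ ≤ p ∧ e x ≠ 1) (a l : ℚ_[p]) (hl : l ≠ 0) (hla : ‖l‖ < ‖a‖) :
    pccP μ e (pccInd a l) := by
  have hapos : 0 < ‖a‖ := lt_of_le_of_lt (norm_nonneg _) hla
  have ha : a ≠ 0 := norm_pos_iff.1 hapos
  have hl2 : l * (a⁻¹ * a⁻¹) ≠ 0 := by simp [hl, ha]
  unfold pccP
  rw [pcc_I_Ind a l hla]
  refine ⟨pcc_Ind_good μ hμ e he he1 he2 a l hl, pcc_good_smul μ e _ _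
    (pcc_Ind_good μ hμ e he he1 he2 _ _ hl2), ?_⟩
  intro t ht
  obtain ⟨K, D, hG⟩ := pcc_G_eq μ hμ e he he1 he2
  rw [pcc_H_smul, pcc_H_Ind μ hμ e he he1 he2 _ _ hl2, pcc_H_Ind μ hμ e he he1 he2 _ _ hl, hG, hG]
  have h3 : ∀ x m : ℚ_[p], m ≠ 0 → (‖x * m⁻¹‖ ≤ 1 ↔ ‖x‖ ≤ ‖m‖) := by
    intro x m hm
    rw [norm_mul, norm_inv, mul_inv_le_iff₀ (norm_pos_iff.2 hm), one_mul]
  unfold pccInd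
  simp only [h3 _ _ hl2, h3 _ _ hl, ← pcc_inv_ball a l t hla ht]
  split_ifs with h
  · have h4 := pcc_norm_eq a t⁻¹ _ hla h
    rw [norm_inv] at h4
    have h5 : ‖t‖ = ‖a‖⁻¹ := by rw [← h4, inv_inv]
    rw [norm_inv, h4, h5, norm_mul, norm_mul, norm_inv, Real.log_inv,
      Real.log_mul (by simpa using hl) (by positivity), Real.log_mul (by positivity) (by positivity),
      Real.log_inv]
    push_cast
    ring
  · simp only [mul_zero, zero_add, sub_zero]
    rw [← mul_assoc (‖a‖ : ℂ), ← mul_assoc ((‖t‖⁻¹ : ℝ) : ℂ), ← Complex.ofReal_mul, ← Complex.ofReal_mul]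
    congr 2
    have h1 : t⁻¹ - a = -(a * t⁻¹ * (t - a⁻¹)) := by field_simp; ring
    have htpos : 0 < ‖t‖ := norm_pos_iff.2 ht
    have hlpos : 0 < ‖l‖ := norm_pos_iff.2 hl
    rw [h1]
    simp only [norm_mul, norm_inv, norm_neg, mul_inv, inv_inv]
    field_simp

theorem pcc_P_zero [MeasurableSpace ℚ_[p]] (μ : Measure ℚ_[p])
    (e : AddChar ℚ_[p] Circle) : pccP μ e (fun _ => 0) := by
  have h : pccI (fun _ : ℚ_[p] => (0:ℂ)) = fun _ => 0 := by
    ext x; unfold pccI; simp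
  have hg : pccGood μ e (fun _ => 0) := by
    constructor
    · simp
    · simp [padicFourierInv]
  unfold pccP
  rw [h]
  refine ⟨hg, hg, ?_⟩
  intro t ht
  simp [padicCondOp, padicFourierInv]

theorem pcc_P_cover [MeasurableSpace ℚ_[p]] [BorelSpace ℚ_[p]]
    (μ : Measure ℚ_[p]) [μ.IsAddHaarMeasure] (hμ : μ {x : ℚ_[p] | ‖x‖ ≤ 1} = 1)
    (e : AddChar ℚ_[p] Circle) (he : Continuous e)
    (he1 : ∀ x : ℤ_[p], e (x : ℚ_[p]) = 1)
    (he2 : ∃ x : ℚ_[p], ‖x‖ ≤ p ∧ e x ≠ 1) (l : ℚ_[p]) (hl : l ≠ 0) (F : Finset ℚ_[p]) :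
    ∀ φ : ℚ_[p] → ℂ, (∀ x y, ‖x - y‖ ≤ ‖l‖ → φ x = φ y) → φ 0 = 0 →
      (∀ x, φ x ≠ 0 → ∃ a ∈ F, ‖x - a‖ ≤ ‖l‖) → pccP μ e φ := by
  induction F using Finset.induction_on with
  | empty =>
    intro φ _ _ h
    have : φ = fun _ => 0 := by
      ext x
      by_contra hx
      obtain ⟨a, ha, -⟩ := h x hx
      simp at ha
    rw [this]
    exact pcc_P_zero μ e
  | insert a F haF ih =>
    intro φ hc h0 hF
    have hu : ∀ x y, ‖x - y‖ ≤ ‖l‖ → (‖x - a‖ ≤ ‖l‖ ↔ ‖y - a‖ ≤ ‖l‖) := by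
      intro x y hxy
      rw [← pcc_ultra (y - a) (x - y) _ hxy]
      have : y - a + (x - y) = x - a := by ring
      rw [this]
    have hdec : φ = fun x => φ a * pccInd a l x + (if ‖x - a‖ ≤ ‖l‖ then 0 else φ x) := by
      ext x
      unfold pccInd
      split_ifs with h
      · rw [hc x a h]; ring
      · ring
    rw [hdec]
    refine pcc_P_add μ e he _ _ ?_ ?_
    · by_cases hla : ‖l‖ < ‖a‖
      · exact pcc_P_smul μ e _ _ (pcc_P_Ind μ hμ e he he1 he2 a l hl hla)
      · push Not at hla
        have : φ a = 0 := by rw [← h0]; exact hc a 0 (by simpa using hla)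
        rw [this]
        simpa using pcc_P_zero μ e
    · refine ih _ ?_ ?_ ?_
      · intro x y hxy
        simp only [hu x y hxy, hc x y hxy]
      · simp [h0]
      · intro x hx
        split_ifs at hx with h
        · exact absurd rfl hx
        · obtain ⟨b, hb, hb2⟩ := hF x hx
          rcases Finset.mem_insert.1 hb with rfl | hb
          · exact absurd hb2 h
          · exact ⟨b, hb, hb2⟩

theorem pcc_main [MeasurableSpace ℚ_[p]] [BorelSpace ℚ_[p]]
    (μ : Measure ℚ_[p]) [μ.IsAddHaarMeasure] (hμ : μ {x : ℚ_[p] | ‖x‖ ≤ 1} = 1)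
    (e : AddChar ℚ_[p] Circle) (he : Continuous e)
    (he1 : ∀ x : ℤ_[p], e (x : ℚ_[p]) = 1)
    (he2 : ∃ x : ℚ_[p], ‖x‖ ≤ p ∧ e x ≠ 1)
    (φ : ℚ_[p] → ℂ) (hφlc : IsLocallyConstant φ) (hφcs : HasCompactSupport φ)
    (hφ0 : φ 0 = 0) : pccP μ e φ := by
  have hK : IsCompact (tsupport φ) := hφcs
  obtain ⟨δ, hδ, hL⟩ := lebesgue_number_lemma_of_metric (c := fun z : ℂ => φ ⁻¹' {z}) hK
    (fun z => hφlc.isOpen_fiber z) (fun x _ => Set.mem_iUnion.2 ⟨φ x, rfl⟩)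
  have hK1 : ∀ x ∈ tsupport φ, ∀ y, dist y x < δ → φ y = φ x := by
    intro x hx y hy
    obtain ⟨z, hz⟩ := hL x hx
    have h1 : φ y = z := hz (Metric.mem_ball.2 hy)
    have h2 : φ x = z := hz (Metric.mem_ball_self hδ)
    rw [h1, h2]
  have hc : ∀ x y, dist x y < δ → φ x = φ y := by
    intro x y hxy
    by_cases hy : y ∈ tsupport φ
    · exact hK1 y hy x hxy
    · by_cases hx : x ∈ tsupport φ
      · exact (hK1 x hx y (by rwa [dist_comm])).symm
      · rw [image_eq_zero_of_notMem_tsupport hx, image_eq_zero_of_notMem_tsupport hy]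
  obtain ⟨l, hl, hlδ⟩ := NormedField.exists_norm_lt ℚ_[p] hδ
  obtain ⟨S, -, hSf, hS⟩ := hK.finite_cover_balls hl
  refine pcc_P_cover μ hμ e he he1 he2 l (norm_pos_iff.1 hl) hSf.toFinset φ ?_ hφ0 ?_
  · intro x y hxy
    exact hc x y (by rw [dist_eq_norm]; linarith)
  · intro x hx
    have := hS (subset_tsupport φ hx)
    simp only [Set.mem_iUnion, Metric.mem_ball, dist_eq_norm] at this
    obtain ⟨a, ha, hxa⟩ := this
    exact ⟨a, by simpa using ha, hxa.le⟩

/-- The conductor operator on `ℚ_p` commutes with the inversion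
`Iφ(t) = |t|_p⁻¹·φ(t⁻¹)` (with `Iφ(0) = 0`): for locally constant, compactly
supported `φ` vanishing near `0` and any `t ≠ 0`,
`H(Iφ)(t) = |t|_p⁻¹·H(φ)(t⁻¹)`. -/
theorem padic_conductor_commutes_with_inversion [MeasurableSpace ℚ_[p]] [BorelSpace ℚ_[p]]
    (μ : Measure ℚ_[p]) [μ.IsAddHaarMeasure] (hμ : μ {x : ℚ_[p] | ‖x‖ ≤ 1} = 1)
    (e : AddChar ℚ_[p] Circle) (he : Continuous e)
    (he1 : ∀ x : ℤ_[p], e (x : ℚ_[p]) = 1)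
    (he2 : ∃ x : ℚ_[p], ‖x‖ ≤ p ∧ e x ≠ 1)
    (φ : ℚ_[p] → ℂ) (hφlc : IsLocallyConstant φ) (hφcs : HasCompactSupport φ)
    (hφ0 : ∀ᶠ s in nhds (0 : ℚ_[p]), φ s = 0)
    (t : ℚ_[p]) (ht : t ≠ 0) :
    padicCondOp μ e (fun s => if s = 0 then 0 else ((‖s‖⁻¹ : ℝ) : ℂ) * φ s⁻¹) t =
      ((‖t‖⁻¹ : ℝ) : ℂ) * padicCondOp μ e φ t⁻¹ := by
  exact (pcc_main μ hμ e he he1 he2 φ hφlc hφcs hφ0.self_of_nhds).2.2 t ht
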